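/- arXiv:2106.13721 — 11 statements merged into one kernel-verified Lean document; each statement's English description precedes it below -/
import Mathlib

section
/- Let Q be a real symmetric n×n matrix, A a real m×n matrix, b ∈ ℝᵐ, α ≥ 0, and d ∈ ℝⁿ a vector such that Q + diag(d) + α AᵀA is positive semidefinite. Then the set {(x, v) ∈ ℝⁿ × ℝ : A x = b and v ≥ xᵀ(Q + diag(d))x} is a convex subset of ℝⁿ × ℝ. (That is, although the quadratic cut v ≥ xᵀ(Q + diag(d))x may be nonconvex, it defines a convex feasible set when intersected with the equality constraints A x = b.) -/
open Matrix

/-- A quadratic form at a convex combination differs from the convex combination of its values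
by a multiple of its value at the difference. -/
lemma dotProduct_mulVec_convex_comb {ι : Type*} [Fintype ι] (M : Matrix ι ι ℝ) (x y : ι → ℝ)
    {s t : ℝ} (hst : s + t = 1) :
    (s • x + t • y) ⬝ᵥ (M *ᵥ (s • x + t • y)) =
      s * (x ⬝ᵥ (M *ᵥ x)) + t * (y ⬝ᵥ (M *ᵥ y)) - s * t * ((x - y) ⬝ᵥ (M *ᵥ (x - y))) := by
  obtain rfl : t = 1 - s := by linarith
  simp only [mulVec_add, mulVec_sub, mulVec_smul, add_dotProduct, dotProduct_add, sub_dotProduct,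
    dotProduct_sub, smul_dotProduct, dotProduct_smul, smul_eq_mul]
  ring

/-- A positive semidefinite matrix `M + α AᵀA` certifies that `M` is nonnegative on `ker A`. -/
lemma dotProduct_mulVec_nonneg_of_mulVec_eq_zero {ι κ : Type*} [Fintype ι] [Fintype κ]
    {M : Matrix ι ι ℝ} {A : Matrix κ ι ℝ} {α : ℝ} (h : (M + α • (Aᵀ * A)).PosSemidef)
    {w : ι → ℝ} (hw : A *ᵥ w = 0) : 0 ≤ w ⬝ᵥ (M *ᵥ w) := by
  simpa [add_mulVec, smul_mulVec, ← mulVec_mulVec, hw] using h.dotProduct_mulVec_nonneg w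

/-- If `Q + diag d + α AᵀA` is PSD (α ≥ 0), then the set
`{(x, v) : A x = b ∧ v ≥ xᵀ(Q + diag d)x}` is convex. -/
theorem stmt_0 {n m : ℕ} (Q : Matrix (Fin n) (Fin n) ℝ) (hQ : Q.IsSymm)
    (A : Matrix (Fin m) (Fin n) ℝ) (b : Fin m → ℝ) (α : ℝ) (hα : 0 ≤ α)
    (d : Fin n → ℝ)
    (hpsd : (Q + Matrix.diagonal d + α • (Aᵀ * A)).PosSemidef) :
    Convex ℝ {p : (Fin n → ℝ) × ℝ |
      A.mulVec p.1 = b ∧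
      p.1 ⬝ᵥ ((Q + Matrix.diagonal d).mulVec p.1) ≤ p.2} := by
  rintro ⟨x, u⟩ ⟨hx, hu⟩ ⟨y, v⟩ ⟨hy, hv⟩ s t hs ht hst
  simp only [Set.mem_ofPred_eq, Prod.fst_add, Prod.snd_add, Prod.smul_fst, Prod.smul_snd,
    smul_eq_mul] at *
  refine ⟨by rw [mulVec_add, mulVec_smul, mulVec_smul, hx, hy, ← add_smul, hst, one_smul], ?_⟩
  have hw := dotProduct_mulVec_nonneg_of_mulVec_eq_zero hpsd (w := x - y)
    (by rw [mulVec_sub, hx, hy, sub_self])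
  rw [dotProduct_mulVec_convex_comb _ x y hst]
  linarith [mul_le_mul_of_nonneg_left hu hs, mul_le_mul_of_nonneg_left hv ht,
    mul_nonneg (mul_nonneg hs ht) hw]
end

section
/- Let Q be a real symmetric n×n matrix, A a real m×n matrix, and Z a real n×(n−m) matrix with A Z = 0 whose columns span the nullspace of A (i.e., every v ∈ ℝⁿ with A v = 0 equals Z w for some w ∈ ℝ^{n−m}). Let d ∈ ℝⁿ be such that Zᵀ(Q + diag(d))Z is positive semidefinite. Then for every w ∈ ℝⁿ there exists α₀ ≥ 0 such that for all α ≥ α₀, wᵀ(Q + diag(d) + α AᵀA) w ≥ 0. (In particular, lim_{α→∞} wᵀ(Q + diag(d) + α AᵀA) w ≥ 0 for every w ∈ ℝⁿ, which is the content of the claim that lim_{α→∞} D_α = D_∞.) -/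
open Matrix

/-- The quadratic form of `M + α • (Aᵀ * A)` splits as that of `M` plus `α` times `A w ⬝ᵥ A w`. -/
lemma dotProduct_add_smul_transpose_mul_self_mulVec {ι κ : Type*} [Fintype ι] [Fintype κ]
    (M : Matrix ι ι ℝ) (A : Matrix κ ι ℝ) (α : ℝ) (w : ι → ℝ) :
    w ⬝ᵥ ((M + α • (Aᵀ * A)) *ᵥ w) = w ⬝ᵥ (M *ᵥ w) + α * ((A *ᵥ w) ⬝ᵥ (A *ᵥ w)) := by
  rw [add_mulVec, dotProduct_add, smul_mulVec, dotProduct_smul, smul_eq_mul, ← mulVec_mulVec,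
    dotProduct_mulVec w Aᵀ, vecMul_transpose]

/-- If `Zᵀ * M * Z` is positive semidefinite, the quadratic form of `M` is nonnegative on the
range of `Z`. -/
lemma Matrix.PosSemidef.dotProduct_mulVec_nonneg_of_range {ι κ : Type*} [Fintype ι] [Fintype κ]
    {M : Matrix ι ι ℝ} {Z : Matrix ι κ ℝ} (h : (Zᵀ * M * Z).PosSemidef) (u : κ → ℝ) :
    0 ≤ (Z *ᵥ u) ⬝ᵥ (M *ᵥ (Z *ᵥ u)) := by
  have := h.dotProduct_mulVec_nonneg u
  rwa [star_trivial, ← mulVec_mulVec, ← mulVec_mulVec, dotProduct_mulVec u Zᵀ,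
    vecMul_transpose] at this

/-- If `Zᵀ(Q + diag d)Z ⪰ 0` where the columns of `Z` span the nullspace of `A`,
then for every `w` there is `α₀ ≥ 0` so that for all `α ≥ α₀`,
`wᵀ(Q + diag d + α AᵀA) w ≥ 0`.  (Content of `lim_{α→∞} D_α = D_∞`.) -/
theorem stmt_3 {n m : ℕ} (Q : Matrix (Fin n) (Fin n) ℝ) (hQ : Q.IsSymm)
    (A : Matrix (Fin m) (Fin n) ℝ)
    (Z : Matrix (Fin n) (Fin (n - m)) ℝ) (hAZ : A * Z = 0)
    (hspan : ∀ v : Fin n → ℝ, A.mulVec v = 0 →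
      ∃ w : Fin (n - m) → ℝ, Z.mulVec w = v)
    (d : Fin n → ℝ)
    (hd : (Zᵀ * (Q + Matrix.diagonal d) * Z).PosSemidef) :
    ∀ w : Fin n → ℝ, ∃ α₀ : ℝ, 0 ≤ α₀ ∧ ∀ α : ℝ, α₀ ≤ α →
      0 ≤ w ⬝ᵥ ((Q + Matrix.diagonal d + α • (Aᵀ * A)).mulVec w) := by
  intro w
  simp only [dotProduct_add_smul_transpose_mul_self_mulVec]
  by_cases hw : A *ᵥ w = 0
  · obtain ⟨u, rfl⟩ := hspan w hw
    refine ⟨0, le_rfl, fun α _ => ?_⟩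
    rw [hw, dotProduct_zero, mul_zero, add_zero]
    exact hd.dotProduct_mulVec_nonneg_of_range u
  · have hpos : 0 < (A *ᵥ w) ⬝ᵥ (A *ᵥ w) :=
      lt_of_le_of_ne (Finset.sum_nonneg fun i _ => mul_self_nonneg _)
        (fun h => hw (dotProduct_self_eq_zero.mp h.symm))
    refine ⟨max 0 (-(w ⬝ᵥ ((Q + diagonal d) *ᵥ w)) / ((A *ᵥ w) ⬝ᵥ (A *ᵥ w))),
      le_max_left _ _, fun α hα => ?_⟩
    have := (div_le_iff₀ hpos).mp ((le_max_right _ _).trans hα)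
    linarith
end

section
/- Let Q be a real symmetric n×n matrix, A a real m×n matrix, b ∈ ℝᵐ, α ≥ 0, and d ∈ ℝⁿ such that Q + diag(d) + α AᵀA is positive semidefinite. Let x̄, ȳ ∈ ℝⁿ and let X̄ be a real symmetric n×n matrix such that: X̄ − x̄ x̄ᵀ is positive semidefinite, X̄ᵢᵢ = ȳᵢ for all i, A x̄ = b, and ⟨AᵀA, X̄⟩ − 2(Aᵀ b)ᵀ x̄ + bᵀ b = 0. Then ⟨Q, X̄⟩ ≥ x̄ᵀ(Q + diag(d)) x̄ − dᵀ ȳ. (This is the key inequality showing that the optimal value of the semi-infinite relaxation SICP is at most that of the semidefinite relaxation SDPda.) -/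
open Matrix

open scoped MatrixOrder Matrix.Norms.L2Operator in
/-- The matrix inner product of two real positive semidefinite matrices is nonnegative. -/
theorem Matrix.PosSemidef.sum_mul_nonneg {ι : Type*} [Fintype ι] {M P : Matrix ι ι ℝ}
    (hM : M.PosSemidef) (hP : P.PosSemidef) : 0 ≤ ∑ i, ∑ j, M i j * P i j := by
  classical
  obtain ⟨B, rfl⟩ := CStarAlgebra.nonneg_iff_eq_star_mul_self.mp hP.nonneg
  rw [star_eq_conjTranspose]
  have h := (hM.mul_mul_conjTranspose_same B).trace_nonneg
  have hS : (Bᴴ * B)ᵀ = Bᴴ * B := by simp [conjTranspose_eq_transpose_of_trivial]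
  rw [Matrix.mul_assoc, Matrix.trace_mul_comm, Matrix.mul_assoc] at h
  have hT : (M * (Bᴴ * B)).trace = ∑ i, ∑ j, M i j * (Bᴴ * B) i j := by
    simp only [Matrix.trace, Matrix.diag_apply]
    refine Finset.sum_congr rfl fun i _ => ?_
    rw [Matrix.mul_apply]
    refine Finset.sum_congr rfl fun j _ => ?_
    rw [← Matrix.transpose_apply (Bᴴ * B) i j, hS]
  rwa [hT] at h

/-- The inner product of a matrix with `x xᵀ` is the quadratic form of the matrix at `x`. -/
theorem Matrix.sum_mul_vecMulVec {ι : Type*} [Fintype ι] (M : Matrix ι ι ℝ) (x : ι → ℝ) :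
    ∑ i, ∑ j, M i j * vecMulVec x x i j = x ⬝ᵥ (M *ᵥ x) := by
  simp only [dotProduct, mulVec, vecMulVec_apply, Finset.mul_sum]
  exact Finset.sum_congr rfl fun i _ => Finset.sum_congr rfl fun j _ => by ring

/-- Key inequality showing `μ_SICPda ≤ μ_SDPda`: if `Q + diag d + α AᵀA ⪰ 0`
(α ≥ 0) and `(xb, yb, Xb)` is feasible in the SDP relaxation (SDPda), then
`⟨Q, Xb⟩ ≥ xbᵀ(Q + diag d)xb − dᵀyb`. -/
theorem stmt_4 {n m : ℕ} (Q : Matrix (Fin n) (Fin n) ℝ) (hQ : Q.IsSymm)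
    (A : Matrix (Fin m) (Fin n) ℝ) (b : Fin m → ℝ) (α : ℝ) (hα : 0 ≤ α)
    (d : Fin n → ℝ)
    (hpsd : (Q + Matrix.diagonal d + α • (Aᵀ * A)).PosSemidef)
    (xb yb : Fin n → ℝ) (Xb : Matrix (Fin n) (Fin n) ℝ) (hXb : Xb.IsSymm)
    (h₁ : (Xb - Matrix.vecMulVec xb xb).PosSemidef)
    (h₂ : ∀ i, Xb i i = yb i)
    (h₃ : A.mulVec xb = b)
    (h₄ : (∑ i, ∑ j, (Aᵀ * A) i j * Xb i j)
          - 2 * ((Aᵀ.mulVec b) ⬝ᵥ xb) + b ⬝ᵥ b = 0) :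
    xb ⬝ᵥ ((Q + Matrix.diagonal d).mulVec xb) - d ⬝ᵥ yb
      ≤ ∑ i, ∑ j, Q i j * Xb i j := by
  have key := hpsd.sum_mul_nonneg h₁
  simp only [Matrix.sub_apply, mul_sub, Finset.sum_sub_distrib] at key
  rw [Matrix.sum_mul_vecMulVec, add_mulVec _ (α • (Aᵀ * A)), dotProduct_add, smul_mulVec,
    dotProduct_smul, smul_eq_mul] at key
  have hAA : xb ⬝ᵥ ((Aᵀ * A) *ᵥ xb) = b ⬝ᵥ b := by
    rw [← mulVec_mulVec, h₃, dotProduct_mulVec, vecMul_transpose, h₃]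
  have hAb : (Aᵀ *ᵥ b) ⬝ᵥ xb = b ⬝ᵥ b := by
    rw [dotProduct_comm, dotProduct_mulVec, vecMul_transpose, h₃]
  have hd : ∑ i, ∑ j, diagonal d i j * Xb i j = d ⬝ᵥ yb := by
    simp [diagonal_apply, dotProduct, h₂]
  simp only [Matrix.add_apply, Matrix.smul_apply, smul_eq_mul, add_mul, mul_assoc,
    Finset.sum_add_distrib, ← Finset.mul_sum] at key
  rw [hd, hAA] at key
  have hX : ∑ i, ∑ j, (Aᵀ * A) i j * Xb i j = b ⬝ᵥ b := by
    rw [hAb] at h₄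
    linarith
  rw [hX] at key
  linarith
end

section
/- Let Q be a real symmetric n×n matrix, A a real m×n matrix, b ∈ ℝᵐ, and Z a real n×(n−m) matrix with A Z = 0 whose columns span the nullspace of A (i.e., every v ∈ ℝⁿ with A v = 0 equals Z w for some w ∈ ℝ^{n−m}). Let d ∈ ℝⁿ be such that Zᵀ(Q + diag(d))Z is positive semidefinite. Let x̄, ȳ ∈ ℝⁿ and let X̄ be a real symmetric n×n matrix such that: X̄ − x̄ x̄ᵀ is positive semidefinite, X̄ᵢᵢ = ȳᵢ for all i, A x̄ = b, and ⟨AᵀA, X̄⟩ − 2(Aᵀ b)ᵀ x̄ + bᵀ b = 0. Then ⟨Q, X̄⟩ ≥ x̄ᵀ(Q + diag(d)) x̄ − dᵀ ȳ. (This gives the inequality μ_{SICPda∞} ≤ μ_{SDPda}, half of the equivalence between the limiting semi-infinite program and the semidefinite relaxation.) -/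
open Matrix

/-- The inner product of a matrix with a vector's outer square is the quadratic form. -/
theorem sum_mul_sub_vecMulVec {n : ℕ} (M X : Matrix (Fin n) (Fin n) ℝ) (x : Fin n → ℝ) :
    ∑ i, ∑ j, M i j * (X - Matrix.vecMulVec x x) i j
      = (∑ i, ∑ j, M i j * X i j) - x ⬝ᵥ M.mulVec x := by
  simp only [Matrix.sub_apply, Matrix.vecMulVec_apply, mul_sub, Finset.sum_sub_distrib,
    dotProduct, Matrix.mulVec, Finset.mul_sum]
  congr 1
  exact Finset.sum_congr rfl fun i _ => Finset.sum_congr rfl fun j _ => by ring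

/-- The inner product with a Gram matrix is a sum of quadratic forms. -/
theorem sum_mul_conjTranspose_mul_self {n : ℕ} (M B : Matrix (Fin n) (Fin n) ℝ) :
    ∑ i, ∑ j, M i j * (Bᴴ * B) i j = ∑ k, B k ⬝ᵥ M.mulVec (B k) := by
  simp only [Matrix.mul_apply, Matrix.conjTranspose_apply, star_trivial, dotProduct,
    Matrix.mulVec, Finset.mul_sum]
  rw [Finset.sum_congr rfl fun i _ => Finset.sum_comm, Finset.sum_comm]
  exact Finset.sum_congr rfl fun k _ => Finset.sum_congr rfl fun i _ =>
    Finset.sum_congr rfl fun j _ => by ring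

/-- The quadratic form of `Aᵀ * A`. -/
theorem dotProduct_transpose_mul_self_mulVec {n m : ℕ} (A : Matrix (Fin m) (Fin n) ℝ)
    (x : Fin n → ℝ) : x ⬝ᵥ (Aᵀ * A).mulVec x = A.mulVec x ⬝ᵥ A.mulVec x := by
  rw [← Matrix.mulVec_mulVec, Matrix.dotProduct_mulVec, Matrix.vecMul_transpose]

/-- Inequality `μ_SICPda∞ ≤ μ_SDPda`: if `Zᵀ(Q + diag d)Z ⪰ 0` where the
columns of `Z` span the nullspace of `A`, and `(xb, yb, Xb)` is feasible in the
SDP relaxation (SDPda), then `⟨Q, Xb⟩ ≥ xbᵀ(Q + diag d)xb − dᵀyb`. -/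
theorem stmt_5 {n m : ℕ} (Q : Matrix (Fin n) (Fin n) ℝ) (hQ : Q.IsSymm)
    (A : Matrix (Fin m) (Fin n) ℝ) (b : Fin m → ℝ)
    (Z : Matrix (Fin n) (Fin (n - m)) ℝ) (hAZ : A * Z = 0)
    (hspan : ∀ v : Fin n → ℝ, A.mulVec v = 0 →
      ∃ w : Fin (n - m) → ℝ, Z.mulVec w = v)
    (d : Fin n → ℝ)
    (hd : (Zᵀ * (Q + Matrix.diagonal d) * Z).PosSemidef)
    (xb yb : Fin n → ℝ) (Xb : Matrix (Fin n) (Fin n) ℝ) (hXb : Xb.IsSymm)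
    (h₁ : (Xb - Matrix.vecMulVec xb xb).PosSemidef)
    (h₂ : ∀ i, Xb i i = yb i)
    (h₃ : A.mulVec xb = b)
    (h₄ : (∑ i, ∑ j, (Aᵀ * A) i j * Xb i j)
          - 2 * ((Aᵀ.mulVec b) ⬝ᵥ xb) + b ⬝ᵥ b = 0) :
    xb ⬝ᵥ ((Q + Matrix.diagonal d).mulVec xb) - d ⬝ᵥ yb
      ≤ ∑ i, ∑ j, Q i j * Xb i j := by
  obtain ⟨B, hB⟩ :
      ∃ B : Matrix (Fin n) (Fin n) ℝ, Xb - Matrix.vecMulVec xb xb = Bᴴ * B := by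
    open scoped MatrixOrder Matrix.Norms.L2Operator in
    exact CStarAlgebra.nonneg_iff_eq_star_mul_self.mp (Matrix.nonneg_iff_posSemidef.mpr h₁)
  have hAB : ∑ k, A.mulVec (B k) ⬝ᵥ A.mulVec (B k) = 0 := by
    have h := sum_mul_sub_vecMulVec (Aᵀ * A) Xb xb
    rw [hB, sum_mul_conjTranspose_mul_self] at h
    simp only [dotProduct_transpose_mul_self_mulVec] at h
    have hb : (Aᵀ.mulVec b) ⬝ᵥ xb = b ⬝ᵥ b := by
      rw [Matrix.mulVec_transpose, ← Matrix.dotProduct_mulVec, h₃]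
    rw [h₃] at h
    rw [hb] at h₄
    linarith
  have hker (k : Fin n) : A.mulVec (B k) = 0 := by
    have h := (Finset.sum_eq_zero_iff_of_nonneg fun k _ =>
      Finset.sum_nonneg fun i _ => mul_self_nonneg (A.mulVec (B k) i)).mp hAB k
      (Finset.mem_univ k)
    exact dotProduct_self_eq_zero.mp h
  have hpos (k : Fin n) : 0 ≤ B k ⬝ᵥ (Q + Matrix.diagonal d).mulVec (B k) := by
    obtain ⟨w, hw⟩ := hspan (B k) (hker k)
    have h := hd.dotProduct_mulVec_nonneg w
    rw [star_trivial, ← Matrix.mulVec_mulVec, ← Matrix.mulVec_mulVec,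
      Matrix.dotProduct_mulVec, Matrix.vecMul_transpose, hw] at h
    exact h
  have h := sum_mul_sub_vecMulVec (Q + Matrix.diagonal d) Xb xb
  rw [hB, sum_mul_conjTranspose_mul_self] at h
  have hnonneg := Finset.sum_nonneg fun k (_ : k ∈ Finset.univ) => hpos k
  have hdiag : ∑ i, ∑ j, (Q + Matrix.diagonal d) i j * Xb i j
      = (∑ i, ∑ j, Q i j * Xb i j) + d ⬝ᵥ yb := by
    simp [add_mul, Finset.sum_add_distrib, Matrix.diagonal_apply, dotProduct, h₂]
  linarith
end

section
/- Let A be a real m×n matrix, b ∈ ℝᵐ, and Z a real n×(n−m) matrix with A Z = 0 and ZᵀZ equal to the identity, whose columns span the nullspace of A (i.e., every v ∈ ℝⁿ with A v = 0 equals Z w for some w ∈ ℝ^{n−m}). Let x̄ ∈ ℝⁿ and let X̄ be a real symmetric n×n matrix such that: A x̄ = b, X̄ − x̄ x̄ᵀ is positive semidefinite, and ⟨AᵀA, X̄⟩ − 2(Aᵀ b)ᵀ x̄ + bᵀ b = 0. Then there exists a real symmetric positive semidefinite (n−m)×(n−m) matrix W̄ such that X̄ = x̄ x̄ᵀ + Z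 W̄ Zᵀ. -/
open Matrix

/-- If `D` is positive semidefinite and `A D Aᵀ` has trace zero, then `A D = 0`. -/
theorem Matrix.PosSemidef.mul_eq_zero_of_trace_conj_eq_zero {m n : Type*} [Fintype m] [Fintype n]
    {A : Matrix m n ℝ} {D : Matrix n n ℝ} (hD : D.PosSemidef)
    (h : (A * D * Aᵀ).trace = 0) : A * D = 0 := by
  classical
  open scoped MatrixOrder Matrix.Norms.L2Operator in
  obtain ⟨C, rfl⟩ := CStarAlgebra.nonneg_iff_eq_star_mul_self.mp hD.nonneg
  simp only [star_eq_conjTranspose, conjTranspose_eq_transpose_of_trivial] at h ⊢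
  have hCA : C * Aᵀ = 0 := by
    rw [← Matrix.trace_conjTranspose_mul_self_eq_zero_iff, ← h]
    simp only [conjTranspose_eq_transpose_of_trivial, transpose_mul, transpose_transpose,
      Matrix.mul_assoc]
  have hAC : A * Cᵀ = 0 := by simpa using congrArg Matrix.transpose hCA
  rw [← Matrix.mul_assoc, hAC, Matrix.zero_mul]

/-- If `Z` has orthonormal columns whose span contains the kernel of `A`, then `Z Zᵀ` fixes every
matrix `D` with `A D = 0`. -/
theorem Matrix.mul_transpose_mul_eq_self_of_mul_eq_zero {m n k l : Type*} [Fintype n]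
    [Fintype k] [DecidableEq k] {A : Matrix m n ℝ} {Z : Matrix n k ℝ} {D : Matrix n l ℝ}
    (hZZ : Zᵀ * Z = 1) (hspan : ∀ v : n → ℝ, A.mulVec v = 0 → ∃ w : k → ℝ, Z.mulVec w = v)
    (hAD : A * D = 0) : Z * (Zᵀ * D) = D := by
  have hcol (j : l) : ∃ w : k → ℝ, Z.mulVec w = D.col j :=
    hspan _ (funext fun i => congrFun (congrFun hAD i) j)
  choose w hw using hcol
  have hD : D = Z * (Matrix.of w)ᵀ := by
    ext i j
    exact (congrFun (hw j) i).symm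
  rw [hD, ← Matrix.mul_assoc Zᵀ, hZZ, Matrix.one_mul]

/-- Characterization of feasible `Xb` in the SDP relaxation (SDPda): any such
`Xb` has the form `xb xbᵀ + Z Wb Zᵀ` with `Wb ⪰ 0`, where `Z` is an orthonormal
basis of the nullspace of `A`. -/
theorem stmt_6 {m n : ℕ} (A : Matrix (Fin m) (Fin n) ℝ) (b : Fin m → ℝ)
    (Z : Matrix (Fin n) (Fin (n - m)) ℝ) (hAZ : A * Z = 0) (hZZ : Zᵀ * Z = 1)
    (hspan : ∀ v : Fin n → ℝ, A.mulVec v = 0 →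
      ∃ w : Fin (n - m) → ℝ, Z.mulVec w = v)
    (xb : Fin n → ℝ) (Xb : Matrix (Fin n) (Fin n) ℝ) (hXb : Xb.IsSymm)
    (hAx : A.mulVec xb = b)
    (hpsd : (Xb - Matrix.vecMulVec xb xb).PosSemidef)
    (htr : (∑ i, ∑ j, (Aᵀ * A) i j * Xb i j)
          - 2 * ((Aᵀ.mulVec b) ⬝ᵥ xb) + b ⬝ᵥ b = 0) :
    ∃ Wb : Matrix (Fin (n - m)) (Fin (n - m)) ℝ,
      Wb.IsSymm ∧ Wb.PosSemidef ∧ Xb = Matrix.vecMulVec xb xb + Z * Wb * Zᵀ := by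
  set D := Xb - Matrix.vecMulVec xb xb with hDdef
  have hDsymm : Dᵀ = D := hpsd.isHermitian
  have htrace : (A * D * Aᵀ).trace = 0 := by
    have hX : (Aᵀ * A * Xb).trace = ∑ i, ∑ j, (Aᵀ * A) i j * Xb i j := by
      simp only [Matrix.trace, Matrix.diag_apply, Matrix.mul_apply (M := Aᵀ * A), hXb.apply]
    have hb : (Aᵀ.mulVec b) ⬝ᵥ xb = b ⬝ᵥ b := by
      rw [mulVec_transpose, ← dotProduct_mulVec, hAx]
    rw [Matrix.trace_mul_comm, ← Matrix.mul_assoc, hDdef, Matrix.mul_sub, Matrix.trace_sub,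
      Matrix.mul_vecMulVec, Matrix.trace_vecMulVec, ← Matrix.mulVec_mulVec, hAx, hX]
    linarith
  have hZD : Z * (Zᵀ * D) = D :=
    Matrix.mul_transpose_mul_eq_self_of_mul_eq_zero hZZ hspan
      (hpsd.mul_eq_zero_of_trace_conj_eq_zero htrace)
  have hDZ : D * Z * Zᵀ = D := by
    simpa only [transpose_mul, transpose_transpose, hDsymm] using congrArg transpose hZD
  have hW : (Zᵀ * D * Z).PosSemidef := hpsd.conjTranspose_mul_mul_same Z
  refine ⟨Zᵀ * D * Z, hW.isHermitian, hW, ?_⟩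
  have hconj : Z * (Zᵀ * D * Z) * Zᵀ = D := by
    rw [← Matrix.mul_assoc, hZD, hDZ]
  rw [hconj, hDdef, add_sub_cancel]
end

section
/- Let A be a nonzero real m×n matrix and b ∈ ℝᵐ. Let x ∈ ℝⁿ satisfy A x = b and let X be a real symmetric n×n matrix satisfying ⟨AᵀA, X⟩ − 2(Aᵀ b)ᵀ x + bᵀ b = 0. Then ⟨AᵀA, X − x xᵀ⟩ = 0, and consequently the matrix X − x xᵀ is not positive definite. (Hence the semidefinite relaxation SDPda admits no strictly feasible solution.) -/
open Matrix

theorem sum_transpose_mul_self_mul {m n R : Type*} [Fintype m] [Fintype n] [CommSemiring R]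
    (A : Matrix m n R) (M : Matrix n n R) :
    ∑ i, ∑ j, (Aᵀ * A) i j * M i j = ∑ k, A k ⬝ᵥ (M *ᵥ A k) := by
  simp only [Matrix.mul_apply, transpose_apply, dotProduct, mulVec, Finset.sum_mul,
    Finset.mul_sum]
  rw [Finset.sum_comm]
  rw [Finset.sum_congr rfl fun j _ => Finset.sum_comm, Finset.sum_comm]
  refine Finset.sum_congr rfl fun k _ => ?_
  rw [Finset.sum_comm]
  exact Finset.sum_congr rfl fun i _ => Finset.sum_congr rfl fun j _ => by ring

theorem sum_transpose_mul_self_mul_vecMulVec {m n R : Type*} [Fintype m] [Fintype n]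
    [CommSemiring R] (A : Matrix m n R) (x : n → R) :
    ∑ i, ∑ j, (Aᵀ * A) i j * vecMulVec x x i j = (A *ᵥ x) ⬝ᵥ (A *ᵥ x) := by
  rw [sum_transpose_mul_self_mul]
  refine Finset.sum_congr rfl fun k _ => ?_
  simp [vecMulVec_mulVec, mulVec, dotProduct_comm x (A k)]

theorem sum_transpose_mul_self_mul_pos {m n : Type*} [Fintype m] [Fintype n]
    {A : Matrix m n ℝ} (hA : A ≠ 0) {M : Matrix n n ℝ} (hM : M.PosDef) :
    0 < ∑ i, ∑ j, (Aᵀ * A) i j * M i j := by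
  rw [sum_transpose_mul_self_mul]
  obtain ⟨k, hk⟩ := Function.ne_iff.mp hA
  refine Finset.sum_pos' (fun k _ => ?_) ⟨k, Finset.mem_univ k, ?_⟩
  · simpa using hM.posSemidef.dotProduct_mulVec_nonneg (A k)
  · simpa using hM.dotProduct_mulVec_pos hk

/-- If `A ≠ 0`, `A x = b` and `⟨AᵀA, X⟩ − 2(Aᵀb)ᵀx + bᵀb = 0`, then
`⟨AᵀA, X − xxᵀ⟩ = 0` and `X − xxᵀ` is not positive definite (hence the SDP
relaxation (SDPda) has no strictly feasible point). -/
theorem stmt_8 {m n : ℕ} (A : Matrix (Fin m) (Fin n) ℝ) (hA : A ≠ 0)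
    (b : Fin m → ℝ) (x : Fin n → ℝ) (hx : A.mulVec x = b)
    (X : Matrix (Fin n) (Fin n) ℝ) (hX : X.IsSymm)
    (h : (∑ i, ∑ j, (Aᵀ * A) i j * X i j)
        - 2 * ((Aᵀ.mulVec b) ⬝ᵥ x) + b ⬝ᵥ b = 0) :
    (∑ i, ∑ j, (Aᵀ * A) i j * (X - Matrix.vecMulVec x x) i j = 0) ∧
    ¬ (X - Matrix.vecMulVec x x).PosDef := by
  have hinner : (Aᵀ *ᵥ b) ⬝ᵥ x = b ⬝ᵥ b := by
    rw [mulVec_transpose, ← dotProduct_mulVec, hx]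
  have hzero : ∑ i, ∑ j, (Aᵀ * A) i j * (X - vecMulVec x x) i j = 0 := by
    simp only [Matrix.sub_apply, mul_sub, Finset.sum_sub_distrib]
    rw [sum_transpose_mul_self_mul_vecMulVec, hx]
    linarith
  exact ⟨hzero, fun hpos => (sum_transpose_mul_self_mul_pos hA hpos).ne' hzero⟩
end

section
/- Let A be a real m×n matrix of rank m (full row rank) and b ∈ ℝᵐ, and set Ω := {x ∈ ℝⁿ : A x = b}. Let C be a real symmetric n×n matrix, c ∈ ℝⁿ, γ ∈ ℝ, and define the quadratic function f(x) = xᵀ C x + cᵀ x + γ. Then f(x) = 0 for all x ∈ Ω if and only if there exist a matrix W ∈ ℝ^{n×m} and a vector β ∈ ℝᵐ such that C = Aᵀ Wᵀ + W A, c = Aᵀ β − 2 W b, and γ = −bᵀ β. -/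
open Matrix

theorem Matrix.exists_right_inverse_of_rank_eq {m n : ℕ} {A : Matrix (Fin m) (Fin n) ℝ}
    (hA : A.rank = m) : ∃ R : Matrix (Fin n) (Fin m) ℝ, A * R = 1 := by
  rw [← Matrix.mulVec_surjective_iff_exists_right_inverse]
  have h : LinearMap.range A.mulVecLin = ⊤ := by
    apply Submodule.eq_top_of_finrank_eq
    rw [Module.finrank_fin_fun]
    exact hA
  exact LinearMap.range_eq_top.mp h

theorem Matrix.IsSymm.dotProduct_mulVec_comm {ι : Type*} [Fintype ι]
    {M : Matrix ι ι ℝ} (hM : M.IsSymm) (u v : ι → ℝ) : u ⬝ᵥ M *ᵥ v = v ⬝ᵥ M *ᵥ u := by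
  rw [dotProduct_mulVec, ← mulVec_transpose, hM.eq, dotProduct_comm]

theorem Matrix.IsSymm.eq_zero_of_dotProduct_mulVec_self {ι : Type*} [Fintype ι]
    {M : Matrix ι ι ℝ} (hM : M.IsSymm) (h : ∀ y, y ⬝ᵥ M *ᵥ y = 0) : M = 0 := by
  classical
  ext i j
  have key : Pi.single i 1 ⬝ᵥ M *ᵥ Pi.single j 1 = 0 := by
    have h1 := h (Pi.single i 1 + Pi.single j 1)
    rw [mulVec_add, add_dotProduct, dotProduct_add, dotProduct_add, h, h,
      hM.dotProduct_mulVec_comm (Pi.single j 1)] at h1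
    linarith
  simpa using key

/-- A quadratic function with symmetric leading part vanishes identically only if
all of its coefficients do. -/
theorem Matrix.IsSymm.quadratic_eq_zero {ι : Type*} [Fintype ι]
    {M : Matrix ι ι ℝ} (hM : M.IsSymm) {d : ι → ℝ} {δ : ℝ}
    (h : ∀ y, y ⬝ᵥ M *ᵥ y + d ⬝ᵥ y + δ = 0) : M = 0 ∧ d = 0 ∧ δ = 0 := by
  have hδ : δ = 0 := by simpa using h 0
  have hneg : ∀ y, y ⬝ᵥ M *ᵥ y - d ⬝ᵥ y + δ = 0 := fun y => by
    simpa [mulVec_neg, sub_eq_add_neg] using h (-y)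
  refine ⟨hM.eq_zero_of_dotProduct_mulVec_self fun y => ?_, ?_, hδ⟩
  · linarith [h y, hneg y]
  · exact dotProduct_self_eq_zero.mp (by linarith [h d, hneg d])

/-- Characterization of quadratic functions vanishing on `{x : A x = b}` for a
full-row-rank `A`: `f(x) = xᵀCx + cᵀx + γ` vanishes on this affine set iff
`C = AᵀWᵀ + WA`, `c = Aᵀβ − 2Wb`, `γ = −bᵀβ` for some `W`, `β`. -/
theorem stmt_9 {m n : ℕ} (A : Matrix (Fin m) (Fin n) ℝ) (hA : A.rank = m)
    (b : Fin m → ℝ)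
    (C : Matrix (Fin n) (Fin n) ℝ) (hC : C.IsSymm) (c : Fin n → ℝ) (γ : ℝ) :
    (∀ x : Fin n → ℝ, A.mulVec x = b →
        x ⬝ᵥ (C.mulVec x) + c ⬝ᵥ x + γ = 0) ↔
    ∃ (W : Matrix (Fin n) (Fin m) ℝ) (β : Fin m → ℝ),
      C = Aᵀ * Wᵀ + W * A ∧
      c = Aᵀ.mulVec β - (2 : ℝ) • W.mulVec b ∧
      γ = -(b ⬝ᵥ β) := by
  constructor
  · intro hf
    obtain ⟨R, hR⟩ := Matrix.exists_right_inverse_of_rank_eq hA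
    set P : Matrix (Fin n) (Fin n) ℝ := 1 - R * A with hP
    have hAP : A * P = 0 := by
      rw [hP, Matrix.mul_sub, ← Matrix.mul_assoc, hR, Matrix.one_mul, Matrix.mul_one, sub_self]
    set x₀ := R *ᵥ b with hx₀
    have hAx₀ : A *ᵥ x₀ = b := by rw [hx₀, mulVec_mulVec, hR, one_mulVec]
    set g := (2 : ℝ) • C *ᵥ x₀ + c with hg
    have hsymm : (Pᵀ * C * P).IsSymm := by
      simp [Matrix.IsSymm, Matrix.transpose_mul, hC.eq, Matrix.mul_assoc]
    have hquad : ∀ y, y ⬝ᵥ (Pᵀ * C * P) *ᵥ y + (Pᵀ *ᵥ g) ⬝ᵥ y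
        + (x₀ ⬝ᵥ C *ᵥ x₀ + c ⬝ᵥ x₀ + γ) = 0 := by
      intro y
      have h := hf (x₀ + P *ᵥ y) (by
        rw [mulVec_add, hAx₀, mulVec_mulVec, hAP, zero_mulVec, add_zero])
      have h1 : y ⬝ᵥ (Pᵀ * C * P) *ᵥ y = (P *ᵥ y) ⬝ᵥ C *ᵥ (P *ᵥ y) := by
        rw [Matrix.mul_assoc, ← mulVec_mulVec, ← mulVec_mulVec, dotProduct_mulVec,
          vecMul_transpose]
      have h2 : (Pᵀ *ᵥ g) ⬝ᵥ y = 2 * ((P *ᵥ y) ⬝ᵥ C *ᵥ x₀) + c ⬝ᵥ (P *ᵥ y) := by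
        rw [mulVec_transpose, ← dotProduct_mulVec, hg, add_dotProduct, smul_dotProduct,
          smul_eq_mul, dotProduct_comm (C *ᵥ x₀)]
      rw [mulVec_add, add_dotProduct, dotProduct_add, dotProduct_add, dotProduct_add,
        hC.dotProduct_mulVec_comm x₀ (P *ᵥ y)] at h
      rw [h1, h2]
      linarith
    obtain ⟨hM, hd, hδ⟩ := hsymm.quadratic_eq_zero hquad
    have hPt : Pᵀ = 1 - Aᵀ * Rᵀ := by simp [hP, Matrix.transpose_mul]
    refine ⟨C * R - (1 / 2 : ℝ) • (Aᵀ * Rᵀ * C * R), Rᵀ *ᵥ g - Rᵀ *ᵥ (C *ᵥ x₀), ?_, ?_, ?_⟩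
    · rw [hPt, hP] at hM
      simp only [Matrix.sub_mul, Matrix.mul_sub, Matrix.one_mul, Matrix.mul_one, transpose_sub,
        transpose_smul, transpose_mul, transpose_transpose, hC.eq, Matrix.mul_smul,
        Matrix.smul_mul, Matrix.mul_assoc] at hM ⊢
      rw [← sub_eq_zero, ← hM]
      module
    · rw [hPt, sub_mulVec, one_mulVec, sub_eq_zero, ← mulVec_mulVec] at hd
      rw [mulVec_sub, ← hd, sub_mulVec, smul_mulVec]
      simp only [hg, hx₀, mulVec_mulVec, Matrix.mul_assoc]
      module
    · have h1 : ∀ v, b ⬝ᵥ Rᵀ *ᵥ v = x₀ ⬝ᵥ v := fun v => by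
        rw [dotProduct_mulVec, vecMul_transpose]
      rw [dotProduct_sub, h1, h1, hg, dotProduct_add, dotProduct_smul, smul_eq_mul,
        dotProduct_comm x₀ c]
      linarith
  · rintro ⟨W, β, rfl, rfl, rfl⟩ x hx
    have h1 : x ⬝ᵥ (Aᵀ * Wᵀ) *ᵥ x = x ⬝ᵥ W *ᵥ b := by
      rw [← mulVec_mulVec, dotProduct_mulVec, vecMul_transpose, hx, dotProduct_mulVec,
        vecMul_transpose, dotProduct_comm]
    have h2 : (Aᵀ *ᵥ β) ⬝ᵥ x = b ⬝ᵥ β := by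
      rw [mulVec_transpose, ← dotProduct_mulVec, hx, dotProduct_comm]
    rw [add_mulVec, dotProduct_add, h1, ← mulVec_mulVec, hx, sub_dotProduct, h2,
      smul_dotProduct, smul_eq_mul, dotProduct_comm (W *ᵥ b)]
    ring
end

section
/- Let A be a real m×n matrix and b ∈ ℝᵐ. Let W ∈ ℝ^{n×m} and β ∈ ℝᵐ, and set C := Aᵀ Wᵀ + W A, c := Aᵀ β − 2 W b, γ := −bᵀ β. Let x̄ ∈ ℝⁿ and let X̄ be a real symmetric n×n matrix such that A x̄ = b, X̄ − x̄ x̄ᵀ is positive semidefinite, and ⟨AᵀA, X̄⟩ − 2(Aᵀ b)ᵀ x̄ + bᵀ b = 0. Then ⟨C, X̄⟩ + cᵀ x̄ + γ = 0. (This shows that the feasible region of the relaxation SDPda is contained in the feasible region of any relaxation SDPdaJ built from lifted quadratics vanishing on {x : A x = b}.) -/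
open Matrix

/-- For positive semidefinite `Y`, the trace of `A Y Aᵀ` vanishes only if `A Y = 0`. -/
theorem mul_eq_zero_of_posSemidef_of_trace_eq_zero {m n : Type*} [Fintype m] [Fintype n]
    {A : Matrix m n ℝ} {Y : Matrix n n ℝ} (hY : Y.PosSemidef)
    (h : (A * Y * Aᵀ).trace = 0) : A * Y = 0 := by
  classical
  open scoped MatrixOrder Matrix.Norms.L2Operator in
  obtain ⟨B, rfl⟩ := CStarAlgebra.nonneg_iff_eq_star_mul_self.mp hY.nonneg
  rw [star_eq_conjTranspose, conjTranspose_eq_transpose_of_trivial] at h ⊢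
  have hB : A * Bᵀ = 0 := by
    rw [← trace_mul_conjTranspose_self_eq_zero_iff, conjTranspose_eq_transpose_of_trivial,
      transpose_mul, transpose_transpose]
    simpa only [Matrix.mul_assoc] using h
  rw [← Matrix.mul_assoc, hB, Matrix.zero_mul]

theorem sum_sum_mul_eq_trace_of_isSymm {n R : Type*} [Fintype n] [NonUnitalNonAssocSemiring R]
    (M : Matrix n n R) {P : Matrix n n R} (hP : P.IsSymm) :
    ∑ i, ∑ j, M i j * P i j = (M * P).trace := by
  simp only [trace, diag_apply, mul_apply, hP.apply]

/-- Feasibility in (SDPda) implies feasibility of any lifted constraint built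
from a quadratic vanishing on `{x : A x = b}`: with `C = AᵀWᵀ + WA`,
`c = Aᵀβ − 2Wb`, `γ = −bᵀβ`, any `(xb, Xb)` feasible in (SDPda) satisfies
`⟨C, Xb⟩ + cᵀxb + γ = 0`. -/
theorem stmt_10 {m n : ℕ} (A : Matrix (Fin m) (Fin n) ℝ) (b : Fin m → ℝ)
    (W : Matrix (Fin n) (Fin m) ℝ) (β : Fin m → ℝ)
    (C : Matrix (Fin n) (Fin n) ℝ) (c : Fin n → ℝ) (γ : ℝ)
    (hCdef : C = Aᵀ * Wᵀ + W * A)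
    (hcdef : c = Aᵀ.mulVec β - (2 : ℝ) • W.mulVec b)
    (hγdef : γ = -(b ⬝ᵥ β))
    (xb : Fin n → ℝ) (Xb : Matrix (Fin n) (Fin n) ℝ) (hXb : Xb.IsSymm)
    (hAx : A.mulVec xb = b)
    (hpsd : (Xb - Matrix.vecMulVec xb xb).PosSemidef)
    (htr : (∑ i, ∑ j, (Aᵀ * A) i j * Xb i j)
          - 2 * ((Aᵀ.mulVec b) ⬝ᵥ xb) + b ⬝ᵥ b = 0) :
    (∑ i, ∑ j, C i j * Xb i j) + c ⬝ᵥ xb + γ = 0 := by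
  rw [sum_sum_mul_eq_trace_of_isSymm _ hXb] at htr ⊢
  have htrace : (A * (Xb - vecMulVec xb xb) * Aᵀ).trace = 0 := by
    rw [Matrix.mul_sub, Matrix.sub_mul, trace_sub, mul_vecMulVec, vecMulVec_mul,
      vecMul_transpose, hAx, trace_vecMulVec, trace_mul_comm, ← Matrix.mul_assoc]
    rw [mulVec_transpose, ← dotProduct_mulVec, hAx] at htr
    linarith
  have hAX : A * Xb = vecMulVec b xb := by
    have h := mul_eq_zero_of_posSemidef_of_trace_eq_zero hpsd htrace
    rwa [Matrix.mul_sub, mul_vecMulVec, hAx, sub_eq_zero] at h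
  have hWA : (W * A * Xb).trace = W.mulVec b ⬝ᵥ xb := by
    rw [Matrix.mul_assoc, hAX, mul_vecMulVec, trace_vecMulVec]
  have hAW : (Aᵀ * Wᵀ * Xb).trace = W.mulVec b ⬝ᵥ xb := by
    rw [← hWA, ← trace_transpose (W * A * Xb), transpose_mul, transpose_mul, hXb.eq,
      trace_mul_comm]
  rw [hCdef, hcdef, hγdef, Matrix.add_mul, trace_add, hAW, hWA, sub_dotProduct,
    smul_dotProduct, mulVec_transpose, ← dotProduct_mulVec, hAx, dotProduct_comm b β, smul_eq_mul]
  ring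
end

section
/- Let A be a real m×n matrix, b ∈ ℝᵐ, and Z a real n×(n−m) matrix with A Z = 0. For each i ∈ {1,…,n} let L_i, U_i ∈ ℝ and let l_i, u_i : ℝ → ℝ be functions. Suppose that: (i) Zᵀ e_i ≠ 0 for all i ∈ {1,…,n} (where e_i is the i-th standard basis vector of ℝⁿ); and (ii) there exists x̃ ∈ ℝⁿ with A x̃ = b, L_i < x̃_i < U_i, l_i(x̃_i) = x̃_i², and l_i(x̃_i) < u_i(x̃_i) for all i ∈ {1,…,n}. Define δ := min_{i∈{1,…,n}} (u_i(x̃_i) − l_i(x̃_i)) / (e_iᵀ Z Zᵀ e_i). Then 0 < δ < ∞, and for every ε with 0 < ε < δ the point given by x_z := 0 ∈ ℝ^{n−m}, y_i := x̃_i² + ε · e_iᵀ Z Zᵀ e_i for i ∈ {1,…,n}, and X_z := ε I_{n−m} is a strictly feasible solution of the projected semidefinite program: X_z − x_z x_zᵀ is positive definite; x̃_i² + 2 x̃_i (e_iᵀ Z x_z) + e_iᵀ Z X_z Zᵀ e_i = y_i for all i; L_i < x̃_i + e_iᵀ Z x_z < U_i for all i; and l_i(x̃_i + e_iᵀ Z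 x_z) < y_i < u_i(x̃_i + e_iᵀ Z x_z) for all i. -/
open Matrix

/-- The diagonal entry of `Z * Zᵀ` at a nonzero row of `Z` is positive. -/
theorem mul_transpose_diag_pos {ι κ : Type*} [Fintype κ] (Z : Matrix ι κ ℝ) (i : ι)
    (h : (fun j => Z i j) ≠ 0) : 0 < (Z * Zᵀ) i i := by
  obtain ⟨j, hj⟩ := Function.ne_iff.mp h
  simp only [mul_apply, transpose_apply]
  exact Finset.sum_pos' (fun k _ => mul_self_nonneg _)
    ⟨j, Finset.mem_univ j, mul_self_pos.mpr hj⟩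

/-- Strict feasibility of the projected SDP (Proposition on sufficient
conditions): under conditions (i) `Zᵀeᵢ ≠ 0` for all `i` and (ii) existence of
an interior point `x̃` with `lᵢ(x̃ᵢ) = x̃ᵢ²` and `lᵢ(x̃ᵢ) < uᵢ(x̃ᵢ)`, the scalar
`δ := minᵢ (uᵢ(x̃ᵢ) − lᵢ(x̃ᵢ))/(eᵢᵀZZᵀeᵢ)` satisfies `0 < δ`, and for every
`0 < ε < δ` the point `x_z = 0`, `yᵢ = x̃ᵢ² + ε eᵢᵀZZᵀeᵢ`, `X_z = ε I` is
strictly feasible in the projected SDP. -/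
theorem stmt_14 {m n : ℕ} (hn : (Finset.univ : Finset (Fin n)).Nonempty)
    (A : Matrix (Fin m) (Fin n) ℝ) (b : Fin m → ℝ)
    (Z : Matrix (Fin n) (Fin (n - m)) ℝ) (hAZ : A * Z = 0)
    (L U : Fin n → ℝ) (l u : Fin n → ℝ → ℝ)
    (hZrow : ∀ i : Fin n, (fun j => Z i j) ≠ 0)
    (xt : Fin n → ℝ) (hAxt : A.mulVec xt = b)
    (hbounds : ∀ i, L i < xt i ∧ xt i < U i)
    (hl : ∀ i, l i (xt i) = (xt i) ^ 2)
    (hlu : ∀ i, l i (xt i) < u i (xt i))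
    (δ : ℝ)
    (hδ : δ = Finset.univ.inf' hn
      (fun i => (u i (xt i) - l i (xt i)) / ((Z * Zᵀ) i i))) :
    0 < δ ∧
    ∀ ε : ℝ, 0 < ε → ε < δ →
      ∀ (xz : Fin (n - m) → ℝ) (y : Fin n → ℝ)
        (Xz : Matrix (Fin (n - m)) (Fin (n - m)) ℝ),
        xz = 0 →
        y = (fun i => (xt i) ^ 2 + ε * ((Z * Zᵀ) i i)) →
        Xz = ε • (1 : Matrix (Fin (n - m)) (Fin (n - m)) ℝ) →
        (Xz - Matrix.vecMulVec xz xz).PosDef ∧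
        (∀ i, (xt i) ^ 2 + 2 * xt i * (Z.mulVec xz i)
            + (Z * Xz * Zᵀ) i i = y i) ∧
        (∀ i, L i < xt i + Z.mulVec xz i ∧ xt i + Z.mulVec xz i < U i) ∧
        (∀ i, l i (xt i + Z.mulVec xz i) < y i ∧
              y i < u i (xt i + Z.mulVec xz i)) := by
  have hq : ∀ i, 0 < (Z * Zᵀ) i i := fun i => mul_transpose_diag_pos Z i (hZrow i)
  subst hδ
  refine ⟨(Finset.lt_inf'_iff hn).mpr fun i _ => div_pos (sub_pos.mpr (hlu i)) (hq i), ?_⟩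
  rintro ε hε hεδ xz y Xz rfl rfl rfl
  simp only [mulVec_zero, Pi.zero_apply, mul_zero, add_zero]
  refine ⟨?_, fun i => by simp, hbounds, fun i => ⟨?_, ?_⟩⟩
  · simpa using PosDef.one.smul hε
  · rw [hl]
    exact lt_add_of_pos_right _ (mul_pos hε (hq i))
  · have h := (lt_div_iff₀ (hq i)).mp ((Finset.lt_inf'_iff hn).mp hεδ i (Finset.mem_univ i))
    rw [hl] at h
    linarith
end

section
/- Let M be a real symmetric positive definite n×n matrix with inverse V = M⁻¹, let i ∈ {1,…,n}, and let Δ ∈ ℝ. Then the matrix M + Δ e_i e_iᵀ is positive definite if and only if Δ > −1 / V_{ii}. (Here V_{ii} > 0 since V is positive definite.) -/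
open Matrix

theorem Matrix.dotProduct_add_smul_vecMulVec_single_mulVec {n : Type*} [Fintype n] [DecidableEq n]
    (M : Matrix n n ℝ) (i : n) (c : ℝ) (x : n → ℝ) :
    x ⬝ᵥ ((M + c • vecMulVec (Pi.single i 1) (Pi.single i 1)) *ᵥ x) =
      x ⬝ᵥ (M *ᵥ x) + c * x i ^ 2 := by
  rw [add_mulVec, smul_mulVec, vecMulVec_mulVec, dotProduct_add, dotProduct_smul]
  simp [sq]

theorem Matrix.PosDef.mulVec_inv_mulVec {n : Type*} [Fintype n] [DecidableEq n]
    {M : Matrix n n ℝ} (hM : M.PosDef) (x : n → ℝ) : M *ᵥ (M⁻¹ *ᵥ x) = x := by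
  rw [mulVec_mulVec, mul_nonsing_inv _ ((isUnit_iff_isUnit_det M).mp hM.isUnit), one_mulVec]

/-- Cauchy–Schwarz for the inner product of `M`, applied to `x` and the `i`-th column of `M⁻¹`. -/
theorem Matrix.PosDef.sq_apply_le_inv_apply_mul {n : Type*} [Fintype n] [DecidableEq n]
    {M : Matrix n n ℝ} (hM : M.PosDef) (i : n) (x : n → ℝ) :
    x i ^ 2 ≤ M⁻¹ i i * (x ⬝ᵥ (M *ᵥ x)) := by
  have hv : 0 < M⁻¹ i i := hM.inv.diag_pos
  set w := M⁻¹ *ᵥ Pi.single i 1 with hw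
  have hwi : w i = M⁻¹ i i := by simp [hw]
  have hMw : M *ᵥ w = Pi.single i 1 := hM.mulVec_inv_mulVec _
  have hwM : w ⬝ᵥ (M *ᵥ x) = x i := by
    have hT : Mᵀ = M := by simpa [IsHermitian] using hM.isHermitian
    rw [dotProduct_mulVec, ← mulVec_transpose, hT, hMw]
    simp
  have h := hM.posSemidef.dotProduct_mulVec_nonneg (M⁻¹ i i • x - x i • w)
  simp only [star_trivial, mulVec_sub, mulVec_smul, hMw, sub_dotProduct, dotProduct_sub,
    smul_dotProduct, dotProduct_smul, hwM, dotProduct_single_one, Pi.sub_apply, Pi.smul_apply,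
    hwi, smul_eq_mul] at h
  have h' : 0 ≤ M⁻¹ i i * (M⁻¹ i i * (x ⬝ᵥ (M *ᵥ x)) - x i ^ 2) := by linarith
  exact sub_nonneg.mp (nonneg_of_mul_nonneg_right h' hv)

/-- Rank-one update of a positive definite matrix: for `M ≻ 0` with inverse
`V = M⁻¹`, the matrix `M + Δ eᵢeᵢᵀ` is positive definite iff `Δ > −1/Vᵢᵢ`. -/
theorem stmt_15 {n : ℕ} (M : Matrix (Fin n) (Fin n) ℝ) (hM : M.PosDef)
    (V : Matrix (Fin n) (Fin n) ℝ) (hV : V = M⁻¹) (i : Fin n) (Δ : ℝ) :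
    (M + Δ • Matrix.vecMulVec (Pi.single i 1) (Pi.single i 1)).PosDef ↔
      -1 / V i i < Δ := by
  subst hV
  have hv : 0 < M⁻¹ i i := hM.inv.diag_pos
  rw [div_lt_iff₀ hv]
  constructor
  · intro h
    set w := M⁻¹ *ᵥ Pi.single i 1 with hw
    have hwi : w i = M⁻¹ i i := by simp [hw]
    have hw0 : w ≠ 0 := fun h0 => hv.ne' (by rw [← hwi, h0, Pi.zero_apply])
    have hpos := h.dotProduct_mulVec_pos hw0
    rw [star_trivial, dotProduct_add_smul_vecMulVec_single_mulVec, hM.mulVec_inv_mulVec,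
      dotProduct_single_one, hwi] at hpos
    have h' : 0 < M⁻¹ i i * (1 + Δ * M⁻¹ i i) := by linarith
    linarith [pos_of_mul_pos_right h' hv.le]
  · intro h
    refine .of_dotProduct_mulVec_pos (hM.isHermitian.add ?_) fun x hx => ?_
    · ext j k
      simp [vecMulVec_apply, mul_comm]
    · rw [star_trivial, dotProduct_add_smul_vecMulVec_single_mulVec]
      have hq : 0 < x ⬝ᵥ (M *ᵥ x) := by simpa using hM.dotProduct_mulVec_pos hx
      have hcs := hM.sq_apply_le_inv_apply_mul i x
      rcases eq_or_ne (x i) 0 with h0 | h0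
      · simpa [h0] using hq
      · refine pos_of_mul_pos_right (a := M⁻¹ i i) ?_ hv.le
        nlinarith [mul_pos (sq_pos_of_ne_zero h0) (by linarith : 0 < 1 + Δ * M⁻¹ i i)]
end

section
/- Let ρ > 0, σ > 0, V > 0, and η, d̄ ∈ ℝ. Define φ := 1/(2V), τ := (η + 2ρ d̄)/(4ρ), κ := σ/(2ρ), and Δ* := −(φ + τ) + √((φ − τ)² + κ). Then Δ* > −1/V (equivalently 1 + Δ* V > 0), and Δ* satisfies the stationarity equation η + 2ρ(d̄ + Δ*) − σ V / (1 + Δ* V) = 0. Moreover, Δ* is the unique real number Δ with Δ > −1/V satisfying η + 2ρ(d̄ + Δ) − σ V / (1 + Δ V) = 0; the other root −(φ + τ) − √((φ − τ)² + κ) of the associated quadratic is strictly less than −1/V. -/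
/-- Closed-form solution of the one-dimensional barrier coordinate
minimization: `Δ* = −(φ+τ) + √((φ−τ)² + κ)` is the unique root of the
stationarity equation `η + 2ρ(d̄+Δ) − σV/(1+ΔV) = 0` with `Δ > −1/V`, while
the other root of the associated quadratic lies strictly below `−1/V`. -/
theorem stmt_16 (ρ σ V η db : ℝ) (hρ : 0 < ρ) (hσ : 0 < σ) (hV : 0 < V)
    (φ τ κ Δ : ℝ)
    (hφ : φ = 1 / (2 * V)) (hτ : τ = (η + 2 * ρ * db) / (4 * ρ))
    (hκ : κ = σ / (2 * ρ))
    (hΔ : Δ = -(φ + τ) + Real.sqrt ((φ - τ) ^ 2 + κ)) :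
    (-1 / V < Δ ∧ 0 < 1 + Δ * V) ∧
    (η + 2 * ρ * (db + Δ) - σ * V / (1 + Δ * V) = 0) ∧
    (∀ Δ' : ℝ, -1 / V < Δ' →
      η + 2 * ρ * (db + Δ') - σ * V / (1 + Δ' * V) = 0 → Δ' = Δ) ∧
    (-(φ + τ) - Real.sqrt ((φ - τ) ^ 2 + κ) < -1 / V) := by
  have hφV : -1 / V = -(2 * φ) := by rw [hφ]; field_simp
  have hκ_pos : 0 < κ := by rw [hκ]; positivity
  have hη : η + 2 * ρ * db = 4 * ρ * τ := by rw [hτ]; field_simp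
  have hσκ : σ = 2 * ρ * κ := by rw [hκ]; field_simp
  have hfac (x : ℝ) : 1 + x * V = V * (x + 2 * φ) := by rw [hφ]; field_simp; ring
  have hquad (x : ℝ) (hx : 0 < x + 2 * φ) :
      η + 2 * ρ * (db + x) - σ * V / (1 + x * V) = 0 ↔ (x + 2 * τ) * (x + 2 * φ) = κ := by
    have hdiff : η + 2 * ρ * (db + x) - σ * V / (1 + x * V)
        = 2 * ρ * ((x + 2 * τ) - κ / (x + 2 * φ)) := by
      have hlin : η + 2 * ρ * (db + x) = 2 * ρ * (x + 2 * τ) := by linear_combination hη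
      rw [hlin, hfac, hσκ]
      field_simp
    rw [hdiff, mul_eq_zero, or_iff_right (by positivity), sub_eq_zero, eq_div_iff hx.ne']
  set s := Real.sqrt ((φ - τ) ^ 2 + κ)
  have hs_sq : s ^ 2 = (φ - τ) ^ 2 + κ := Real.sq_sqrt (by positivity)
  obtain ⟨hs_lower, hs_upper⟩ : -s < φ - τ ∧ φ - τ < s :=
    abs_lt.mp (Real.lt_sqrt_of_sq_lt (by rw [sq_abs]; linarith))
  have hΔ_pos : 0 < Δ + 2 * φ := by linarith
  have hΔ_quad : (Δ + 2 * τ) * (Δ + 2 * φ) = κ := by rw [hΔ]; linear_combination hs_sq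
  refine ⟨⟨by linarith, by rw [hfac]; positivity⟩, (hquad Δ hΔ_pos).2 hΔ_quad, ?_, by linarith⟩
  intro x hx hx_eq
  have hx_pos : 0 < x + 2 * φ := by linarith
  have hx_quad := (hquad x hx_pos).1 hx_eq
  have hprod : (x - Δ) * (x + Δ + 2 * φ + 2 * τ) = 0 := by linear_combination hx_quad - hΔ_quad
  have hsum : x + Δ + 2 * φ + 2 * τ ≠ 0 := ne_of_gt (by linarith)
  exact sub_eq_zero.mp ((mul_eq_zero.mp hprod).resolve_right hsum)
end
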